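/- arXiv:2211.02151 — 2 statements merged into one kernel-verified Lean document; each statement's English description precedes it below -/
import Mathlib

section
/- Let g : ℝ^a × ℝ^b → ℝ^q × ℝ^b be differentiable at (v, x_S) with components g = (g_{S^c}, g_S). Suppose the partial derivative of g_S with respect to its second argument at (v, x_S) is the identity map on ℝ^b, and the partial derivative of g_{S^c} with respect to its second argument at (v, x_S) is the zero map (zero elasticity, i.e. x_{S^c} is locally unaffected by x_S). Then for every d_S ∈ ℝ^b, lim_{t → 0, t ≠ 0} ‖g(v, x_S + t·d_S) − g(v, x_S)‖² / t² = ‖d_S‖², i.e. the recourse cost coincides with the direct cost of the independently-manipulable-features setting. -/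
open Filter Topology

/-- The squared norm of the increment of `f` along a direction, divided by the squared step,
tends to the squared norm of the directional derivative. -/
theorem HasFDerivAt.tendsto_sq_norm_sub_div_sq {E F : Type*}
    [NormedAddCommGroup E] [NormedSpace ℝ E] [NormedAddCommGroup F] [NormedSpace ℝ F]
    {f : E → F} {f' : E →L[ℝ] F} {x : E} (hf : HasFDerivAt f f' x) (d : E) :
    Tendsto (fun t : ℝ => ‖f (x + t • d) - f x‖ ^ 2 / t ^ 2) (𝓝[≠] 0) (𝓝 (‖f' d‖ ^ 2)) := by
  refine ((hf.hasLineDerivAt d).tendsto_slope_zero.norm.pow 2).congr fun t => ?_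
  rw [norm_smul, mul_pow, norm_inv, inv_pow, Real.norm_eq_abs, sq_abs, div_eq_inv_mul]

/-- Proposition 1, independently-manipulable-features case: if the partial
derivative of `g_S` with respect to the second argument is the identity map and the partial
derivative of `g_{S^c}` with respect to the second argument is the zero map (zero elasticity),
then for every `d_S`,
`lim_{t → 0, t ≠ 0} ‖g(v, x_S + t·d_S) − g(v, x_S)‖² / t² = ‖d_S‖²`,
where the norm on the product satisfies `‖(u, w)‖² = ‖u‖² + ‖w‖²`. -/
theorem recourse_cost_imf_case {a b q : ℕ}
    (g : EuclideanSpace ℝ (Fin a) × EuclideanSpace ℝ (Fin b) →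
      EuclideanSpace ℝ (Fin q) × EuclideanSpace ℝ (Fin b))
    (v : EuclideanSpace ℝ (Fin a)) (xS : EuclideanSpace ℝ (Fin b))
    (hg : DifferentiableAt ℝ g (v, xS))
    (hB : HasFDerivAt (fun x => (g (v, x)).1)
      (0 : EuclideanSpace ℝ (Fin b) →L[ℝ] EuclideanSpace ℝ (Fin q)) xS)
    (hD : HasFDerivAt (fun x => (g (v, x)).2)
      (ContinuousLinearMap.id ℝ (EuclideanSpace ℝ (Fin b))) xS)
    (dS : EuclideanSpace ℝ (Fin b)) :
    Tendsto
      (fun t : ℝ =>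
        (‖(g (v, xS + t • dS)).1 - (g (v, xS)).1‖ ^ 2 +
            ‖(g (v, xS + t • dS)).2 - (g (v, xS)).2‖ ^ 2) / t ^ 2)
      (𝓝[≠] (0 : ℝ)) (𝓝 (‖dS‖ ^ 2)) := by
  simpa [add_div] using
    (hB.tendsto_sq_norm_sub_div_sq dS).add (hD.tendsto_sq_norm_sub_div_sq dS)
end

section
/- Let λ > 0 be a real number, Y : ℝ^s → ℝ^d a linear map (the generator Jacobian), u ∈ ℝ^d (the classifier gradient ∇f(x)), and m ∈ ℝ (the score gap s − f(x)). Set w = Yᵀ u ∈ ℝ^s and define the surrogate recourse loss L(d) = λ·‖d‖² + (m − ⟨u, Y d⟩)² for d ∈ ℝ^s. Then d* = (m / (λ + ‖w‖²))·w is the unique global minimizer of L: L(d*) ≤ L(d) for all d ∈ ℝ^s, with equality if and only if d = d*. -/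
open RealInnerProductSpace

/-- Completing the square for the ridge loss `λ‖x‖² + (c(λ + ‖w‖²) - ⟪w, x⟫)²` at `c • w`. -/
theorem ridge_loss_eq_add_sq {E : Type*} [NormedAddCommGroup E] [InnerProductSpace ℝ E]
    (lam c : ℝ) (w x : E) :
    lam * ‖x‖ ^ 2 + (c * (lam + ‖w‖ ^ 2) - ⟪w, x⟫) ^ 2 =
      lam * ‖c • w‖ ^ 2 + (c * (lam + ‖w‖ ^ 2) - ⟪w, c • w⟫) ^ 2 +
        (lam * ‖x - c • w‖ ^ 2 + ⟪w, x - c • w⟫ ^ 2) := by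
  rw [norm_sub_sq_real, inner_sub_right, real_inner_smul_right, real_inner_smul_right,
    real_inner_self_eq_norm_sq, real_inner_comm, norm_smul, mul_pow, Real.norm_eq_abs, sq_abs]
  ring

/-- Proposition 2, Direct action: with `w = Yᵀ u`, the vector
`d* = (m / (λ + ‖w‖²))·w` is the unique global minimizer of the surrogate recourse loss
`L(d) = λ·‖d‖² + (m − ⟨u, Y d⟩)²`. -/
theorem optimal_direct_action {s d : ℕ} (lam : ℝ) (hlam : 0 < lam)
    (Y : EuclideanSpace ℝ (Fin s) →L[ℝ] EuclideanSpace ℝ (Fin d))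
    (u : EuclideanSpace ℝ (Fin d)) (m : ℝ)
    (w : EuclideanSpace ℝ (Fin s)) (hw : w = ContinuousLinearMap.adjoint Y u)
    (L : EuclideanSpace ℝ (Fin s) → ℝ)
    (hL : ∀ dv : EuclideanSpace ℝ (Fin s), L dv = lam * ‖dv‖ ^ 2 + (m - ⟪u, Y dv⟫) ^ 2)
    (dstar : EuclideanSpace ℝ (Fin s)) (hdstar : dstar = (m / (lam + ‖w‖ ^ 2)) • w) :
    ∀ dv : EuclideanSpace ℝ (Fin s), L dstar ≤ L dv ∧ (L dstar = L dv ↔ dv = dstar) := by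
  intro dv
  have hpos : 0 < lam + ‖w‖ ^ 2 := by positivity
  have hm : m = m / (lam + ‖w‖ ^ 2) * (lam + ‖w‖ ^ 2) := (div_mul_cancel₀ m hpos.ne').symm
  have hinner (x : EuclideanSpace ℝ (Fin s)) : ⟪u, Y x⟫ = ⟪w, x⟫ := by
    rw [hw, ContinuousLinearMap.adjoint_inner_left]
  have key : L dv = L dstar + (lam * ‖dv - dstar‖ ^ 2 + ⟪w, dv - dstar⟫ ^ 2) := by
    have h := ridge_loss_eq_add_sq lam (m / (lam + ‖w‖ ^ 2)) w dv
    rw [← hm, ← hdstar] at h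
    rw [hL, hL, hinner, hinner, h]
  have hgap : 0 ≤ lam * ‖dv - dstar‖ ^ 2 := by positivity
  have hsq := sq_nonneg ⟪w, dv - dstar⟫
  refine ⟨by linarith, fun h => ?_, fun h => by rw [h]⟩
  have hzero : lam * ‖dv - dstar‖ ^ 2 = 0 := by linarith
  simpa [hlam.ne', sub_eq_zero] using hzero
end
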